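/- arXiv:1304.7340 — 7 statements merged into one kernel-verified Lean document; each statement's English description precedes it below -/
import Mathlib

section
/- Let T be a Lie triple system over a field F and let I be an ideal of T. If C_T(I) = 0, then I is an essential ideal of T. Moreover, if T is semiprime, then I ∩ C_T(I) = 0 and I is essential if and only if C_T(I) = 0. -/
/-- A Lie triple system structure on an `F`-vector space `S`:
a trilinear map `b` satisfying `[x,x,z] = 0`, the cyclic identity and the
Leibniz (derivation) identity. -/
structure LTSStruct (F : Type*) (S : Type*) [Field F] [AddCommGroup S] [Module F S] where
  b : S → S → S → S
  add₁ : ∀ x x' y z, b (x + x') y z = b x y z + b x' y z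
  smul₁ : ∀ (c : F) (x y z : S), b (c • x) y z = c • b x y z
  add₂ : ∀ x y y' z, b x (y + y') z = b x y z + b x y' z
  smul₂ : ∀ (c : F) (x y z : S), b x (c • y) z = c • b x y z
  add₃ : ∀ x y z z', b x y (z + z') = b x y z + b x y z'
  smul₃ : ∀ (c : F) (x y z : S), b x y (c • z) = c • b x y z
  alt : ∀ x z, b x x z = 0
  cyclic : ∀ x y z, b x y z + b y z x + b z x y = 0
  leibniz : ∀ u v x y z,
    b u v (b x y z) = b (b u v x) y z + b x (b u v y) z + b x y (b u v z)

namespace LTSStruct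

variable {F : Type*} [Field F] {S : Type*} [AddCommGroup S] [Module F S]

/-- `I` is an ideal of the whole Lie triple system `S`: `[I,S,S] ⊆ I`. -/
def IsIdeal (L : LTSStruct F S) (I : Submodule F S) : Prop :=
  ∀ x ∈ I, ∀ y z : S, L.b x y z ∈ I

/-- `T` is a subsystem of `S`: `[T,T,T] ⊆ T`. -/
def IsSubsystem (L : LTSStruct F S) (T : Submodule F S) : Prop :=
  ∀ x ∈ T, ∀ y ∈ T, ∀ z ∈ T, L.b x y z ∈ T

/-- `I` is an ideal of the subsystem `T`: `I ⊆ T` and `[I,T,T] ⊆ I`. -/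
def IsIdealOf (L : LTSStruct F S) (I T : Submodule F S) : Prop :=
  I ≤ T ∧ ∀ x ∈ I, ∀ y ∈ T, ∀ z ∈ T, L.b x y z ∈ I

/-- The centralizer of a subset `I` in the whole system `S`:
`C_S(I) = {x ∈ S : [x,I,S] = [S,I,x] = 0}`. -/
def centralizer (L : LTSStruct F S) (I : Set S) : Set S :=
  {x | (∀ i ∈ I, ∀ t : S, L.b x i t = 0) ∧ (∀ t : S, ∀ i ∈ I, L.b t i x = 0)}

/-- The centralizer of a subset `I` in a subsystem `T`:
`C_T(I) = {x ∈ T : [x,I,T] = [T,I,x] = 0}`. -/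
def relCentralizer (L : LTSStruct F S) (T : Submodule F S) (I : Set S) : Set S :=
  {x | x ∈ T ∧ (∀ i ∈ I, ∀ t ∈ T, L.b x i t = 0) ∧ (∀ t ∈ T, ∀ i ∈ I, L.b t i x = 0)}

/-- The center `C(S) = {x ∈ S : [x,S,S] = 0}`. -/
def center (L : LTSStruct F S) : Set S := {x | ∀ y z : S, L.b x y z = 0}

/-- The center of a subsystem `T`: `C(T) = {x ∈ T : [x,T,T] = 0}`. -/
def relCenter (L : LTSStruct F S) (T : Submodule F S) : Set S :=
  {x | x ∈ T ∧ ∀ y ∈ T, ∀ z ∈ T, L.b x y z = 0}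

/-- `S` is semiprime: `[S,I,I] ≠ 0` for every nonzero ideal `I`. -/
def IsSemiprime (L : LTSStruct F S) : Prop :=
  ∀ I : Submodule F S, L.IsIdeal I → I ≠ ⊥ → ∃ t : S, ∃ i ∈ I, ∃ j ∈ I, L.b t i j ≠ 0

/-- `S` is prime: `[S,I,J] ≠ 0` for all nonzero ideals `I`, `J`. -/
def IsPrime (L : LTSStruct F S) : Prop :=
  ∀ I J : Submodule F S, L.IsIdeal I → L.IsIdeal J → I ≠ ⊥ → J ≠ ⊥ →
    ∃ t : S, ∃ i ∈ I, ∃ j ∈ J, L.b t i j ≠ 0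

/-- `S` is nondegenerate: `[S,x,x] ≠ 0` for every nonzero `x`. -/
def IsNondegenerate (L : LTSStruct F S) : Prop :=
  ∀ x : S, x ≠ 0 → ∃ t : S, L.b t x x ≠ 0

/-- A subsystem `T` is semiprime: `[T,I,I] ≠ 0` for every nonzero ideal `I` of `T`. -/
def RelSemiprime (L : LTSStruct F S) (T : Submodule F S) : Prop :=
  ∀ I : Submodule F S, L.IsIdealOf I T → I ≠ ⊥ → ∃ t ∈ T, ∃ i ∈ I, ∃ j ∈ I, L.b t i j ≠ 0

/-- A subsystem `T` is prime: `[T,I,J] ≠ 0` for all nonzero ideals `I`, `J` of `T`. -/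
def RelPrime (L : LTSStruct F S) (T : Submodule F S) : Prop :=
  ∀ I J : Submodule F S, L.IsIdealOf I T → L.IsIdealOf J T → I ≠ ⊥ → J ≠ ⊥ →
    ∃ t ∈ T, ∃ i ∈ I, ∃ j ∈ J, L.b t i j ≠ 0

/-- A subsystem `T` is nondegenerate: `[T,x,x] ≠ 0` for every nonzero `x ∈ T`. -/
def RelNondegenerate (L : LTSStruct F S) (T : Submodule F S) : Prop :=
  ∀ x ∈ T, x ≠ 0 → ∃ t ∈ T, L.b t x x ≠ 0

/-- An ideal `I` of `S` is essential if it hits every nonzero ideal of `S`. -/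
def IsEssentialIdeal (L : LTSStruct F S) (I : Submodule F S) : Prop :=
  L.IsIdeal I ∧ ∀ J : Submodule F S, L.IsIdeal J → J ≠ ⊥ → I ⊓ J ≠ ⊥

/-- An ideal `I` of the subsystem `T` is essential in `T` if it hits every
nonzero ideal of `T`. -/
def IsEssentialIdealOf (L : LTSStruct F S) (I T : Submodule F S) : Prop :=
  L.IsIdealOf I T ∧ ∀ J : Submodule F S, L.IsIdealOf J T → J ≠ ⊥ → I ⊓ J ≠ ⊥

/-- The elements `s`, `R(x₁,y₁)⋯R(xₙ,yₙ)(s)` with all `xᵢ, yᵢ ∈ T`, where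
`R(x,y)(z) = [z,x,y]`. -/
inductive InIter (L : LTSStruct F S) (T : Submodule F S) (s : S) : S → Prop
  | base : InIter L T s s
  | step (z x y : S) : InIter L T s z → x ∈ T → y ∈ T → InIter L T s (L.b z x y)

/-- `_T(s)`: the linear span in `S` of `s` and all `R(x₁,y₁)⋯R(xₙ,yₙ)(s)`,
`xᵢ, yᵢ ∈ T`. -/
def innerIdeal (L : LTSStruct F S) (T : Submodule F S) (s : S) : Submodule F S :=
  Submodule.span F {z | InIter L T s z}

/-- `(T:s) = {x ∈ T : [x,T,_T(s)] + [x,_T(s),T] ⊆ T}`. -/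
def quotSet (L : LTSStruct F S) (T : Submodule F S) (s : S) : Set S :=
  {x | x ∈ T ∧ ∀ t ∈ T, ∀ u ∈ L.innerIdeal T s, L.b x t u ∈ T ∧ L.b x u t ∈ T}

/-- `S` is a system of quotients of `T`. -/
def IsSystemOfQuotients (L : LTSStruct F S) (T : Submodule F S) : Prop :=
  L.IsSubsystem T ∧ ∀ s s' : S, s ≠ 0 →
    ∃ x ∈ T, ∃ y ∈ T, L.b s x y ≠ 0 ∧ (x ∈ L.quotSet T s' ∨ y ∈ L.quotSet T s')

/-- `S` is a weak system of quotients of `T`. -/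
def IsWeakSystemOfQuotients (L : LTSStruct F S) (T : Submodule F S) : Prop :=
  L.IsSubsystem T ∧ ∀ s : S, s ≠ 0 → ∃ x ∈ T, ∃ y ∈ T, L.b s x y ≠ 0 ∧ L.b s x y ∈ T

/-- `S` is ideally absorbed into `T`: for every `0 ≠ s ∈ S` there is an ideal `I`
of `T` with `C_T(I) = 0` and `0 ≠ [s,I,T] + [s,T,I] ⊆ T`. -/
def IsIdeallyAbsorbed (L : LTSStruct F S) (T : Submodule F S) : Prop :=
  L.IsSubsystem T ∧ ∀ s : S, s ≠ 0 → ∃ I : Submodule F S, L.IsIdealOf I T ∧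
    L.relCentralizer T (I : Set S) = {0} ∧
    (∃ i ∈ I, ∃ t ∈ T, L.b s i t ≠ 0 ∨ L.b s t i ≠ 0) ∧
    (∀ i ∈ I, ∀ t ∈ T, L.b s i t ∈ T ∧ L.b s t i ∈ T)

end LTSStruct

namespace LTSStruct

variable {F : Type*} [Field F] {S : Type*} [AddCommGroup S] [Module F S]

theorem b_swap (L : LTSStruct F S) (x y z : S) : L.b x y z = -L.b y x z := by
  have h := L.alt (x + y) z
  rw [L.add₁, L.add₂, L.add₂, L.alt, L.alt, zero_add, add_zero] at h
  exact eq_neg_of_add_eq_zero_left h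

theorem b_zero_left (L : LTSStruct F S) (y z : S) : L.b 0 y z = 0 := by
  simpa using L.smul₁ 0 0 y z

theorem b_zero_mid (L : LTSStruct F S) (x z : S) : L.b x 0 z = 0 := by
  simpa using L.smul₂ 0 x 0 z

theorem b_zero_right (L : LTSStruct F S) (x y : S) : L.b x y 0 = 0 := by
  simpa using L.smul₃ 0 x y 0

theorem b_eq_neg_sub (L : LTSStruct F S) (x y z : S) :
    L.b x y z = -L.b y z x - L.b z x y := by
  have h := L.cyclic x y z
  rw [add_assoc] at h
  rw [eq_neg_of_add_eq_zero_left h, neg_add']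

namespace IsIdeal

variable {L : LTSStruct F S} {I : Submodule F S}

theorem b_mem_mid (hI : L.IsIdeal I) {y : S} (hy : y ∈ I) (x z : S) : L.b x y z ∈ I := by
  rw [L.b_swap]
  exact I.neg_mem (hI y hy x z)

theorem b_mem_right (hI : L.IsIdeal I) {z : S} (hz : z ∈ I) (x y : S) : L.b x y z ∈ I := by
  rw [L.b_eq_neg_sub]
  exact I.sub_mem (I.neg_mem (hI.b_mem_mid hz y x)) (hI z hz x y)

theorem inf {J : Submodule F S} (hI : L.IsIdeal I) (hJ : L.IsIdeal J) : L.IsIdeal (I ⊓ J) :=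
  fun x hx y z => ⟨hI x hx.1 y z, hJ x hx.2 y z⟩

/-- Ideals with zero intersection centralize each other. -/
theorem subset_centralizer {J : Submodule F S} (hI : L.IsIdeal I) (hJ : L.IsIdeal J)
    (h : I ⊓ J = ⊥) : (J : Set S) ⊆ L.centralizer I := by
  refine fun x hx => ⟨fun i hi t => ?_, fun t i hi => ?_⟩
  · exact (Submodule.mem_bot F).1 (h ▸ ⟨hI.b_mem_mid hi x t, hJ x hx i t⟩)
  · exact (Submodule.mem_bot F).1 (h ▸ ⟨hI.b_mem_mid hi t x, hJ.b_mem_right hx t i⟩)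

end IsIdeal

/-- The centralizer of a set, as a subspace. -/
def centralizerSubmodule (L : LTSStruct F S) (I : Set S) : Submodule F S where
  carrier := L.centralizer I
  zero_mem' := ⟨fun i _ t => L.b_zero_left i t, fun t i _ => L.b_zero_right t i⟩
  add_mem' hx hy :=
    ⟨fun i hi t => by rw [L.add₁, hx.1 i hi, hy.1 i hi, add_zero],
      fun t i hi => by rw [L.add₃, hx.2 t i hi, hy.2 t i hi, add_zero]⟩
  smul_mem' c _ hx :=
    ⟨fun i hi t => by rw [L.smul₁, hx.1 i hi, smul_zero],
      fun t i hi => by rw [L.smul₃, hx.2 t i hi, smul_zero]⟩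

theorem IsIdeal.centralizerSubmodule {L : LTSStruct F S} {I : Submodule F S}
    (hI : L.IsIdeal I) : L.IsIdeal (L.centralizerSubmodule I) := by
  intro x hx
  have h_right : ∀ u i, i ∈ I → L.b x u i = 0 := fun u i hi => by
    rw [L.b_eq_neg_sub, hx.2 u i hi, L.b_swap i x u, hx.1 i hi u, neg_zero, sub_zero]
  have h_outer : ∀ u v t i, i ∈ I → L.b t i (L.b x u v) = 0 := fun u v t i hi => by
    rw [L.leibniz, hx.2 t i hi, L.b_zero_left, hx.1 _ (hI.b_mem_mid hi t u) v,
      h_right u _ (hI.b_mem_mid hi t v), add_zero, add_zero]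
  refine fun u v => ⟨fun i hi t => ?_, fun t i hi => h_outer u v t i hi⟩
  have h := L.leibniz x u v i t
  rw [h_right u _ (hI.b_mem_mid hi v t), h_right u i hi, L.b_zero_mid,
    h_outer u t v i hi, add_zero, add_zero] at h
  exact h.symm

theorem IsSemiprime.inf_centralizerSubmodule_eq_bot {L : LTSStruct F S} (hL : L.IsSemiprime)
    {I : Submodule F S} (hI : L.IsIdeal I) : I ⊓ L.centralizerSubmodule I = ⊥ := by
  by_contra h
  obtain ⟨t, i, hi, j, hj, hne⟩ := hL _ (hI.inf hI.centralizerSubmodule) h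
  exact hne (hj.2.2 t i hi.1)

end LTSStruct

/-- if `C_T(I) = 0` then `I` is essential; moreover, if `T` is
semiprime then `I ∩ C_T(I) = 0` and `I` is essential iff `C_T(I) = 0`. -/
theorem essential_of_centralizer_eq_bot {F T : Type*} [Field F] [AddCommGroup T] [Module F T]
    (L : LTSStruct F T) (I : Submodule F T) (hI : L.IsIdeal I) :
    (L.centralizer (I : Set T) = {0} → L.IsEssentialIdeal I) ∧
    (L.IsSemiprime →
      ((I : Set T) ∩ L.centralizer (I : Set T) = {0} ∧
        (L.IsEssentialIdeal I ↔ L.centralizer (I : Set T) = {0}))) := by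
  have h_ess : L.centralizer (I : Set T) = {0} → L.IsEssentialIdeal I := fun hC =>
    ⟨hI, fun J hJ hJ0 h => hJ0 <| J.eq_bot_iff.2 fun x hx => by
      simpa [hC] using hI.subset_centralizer hJ h hx⟩
  refine ⟨h_ess, fun hL => ?_⟩
  have h := hL.inf_centralizerSubmodule_eq_bot hI
  refine ⟨congrArg (fun J : Submodule F T => (J : Set T)) h, fun hE => ?_, h_ess⟩
  have h_bot : L.centralizerSubmodule I = ⊥ := by
    by_contra hne
    exact hE.2 _ hI.centralizerSubmodule hne h
  exact congrArg (fun J : Submodule F T => (J : Set T)) h_bot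
end

section
/- Let A be the real vector space of 2×2 real matrices whose second row is zero, equipped with the trilinear product [E,F,G] = EFG − FEG − GEF + GFE (matrix products). Then A is a Lie triple system over ℝ whose center C(A) is zero, but A is not semiprime: the subspace I of matrices with both first column and second row zero is a nonzero ideal of A with [A,I,I] = 0. -/
/-- The linear map sending a `2 × 2` real matrix to its second row. -/
def secondRow : Matrix (Fin 2) (Fin 2) ℝ →ₗ[ℝ] (Fin 2 → ℝ) where
  toFun M := M 1
  map_add' := fun _ _ => rfl
  map_smul' := fun _ _ => rfl

/-- The subspace `A` of `2 × 2` real matrices whose second row is zero. -/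
def matrixA : Submodule ℝ (Matrix (Fin 2) (Fin 2) ℝ) := LinearMap.ker secondRow

namespace LTSStruct

/-- The Lie triple system structure `[x,y,z] = ⁅⁅x,y⁆,z⁆` on a submodule of an associative
algebra that is closed under this double bracket. -/
def ofAlgebra {F L : Type*} [Field F] [Ring L] [Algebra F L] (T : Submodule F L)
    (hT : ∀ x ∈ T, ∀ y ∈ T, ∀ z ∈ T, ⁅⁅x, y⁆, z⁆ ∈ T) : LTSStruct F T where
  b x y z := ⟨⁅⁅(x : L), (y : L)⁆, (z : L)⁆, hT x x.2 y y.2 z z.2⟩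
  add₁ _ _ _ _ := by ext; simp only [Submodule.coe_add, Ring.lie_def]; noncomm_ring
  smul₁ _ _ _ _ := by ext; simp [Ring.lie_def, smul_sub, mul_sub, sub_mul]
  add₂ _ _ _ _ := by ext; simp only [Submodule.coe_add, Ring.lie_def]; noncomm_ring
  smul₂ _ _ _ _ := by ext; simp [Ring.lie_def, smul_sub, mul_sub, sub_mul]
  add₃ _ _ _ _ := by ext; simp only [Submodule.coe_add, Ring.lie_def]; noncomm_ring
  smul₃ _ _ _ _ := by ext; simp [Ring.lie_def, smul_sub, mul_sub, sub_mul]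
  alt _ _ := by ext; simp [Ring.lie_def]
  cyclic x y z := by
    ext
    simp only [Submodule.coe_add, Submodule.coe_zero, Ring.lie_def]
    noncomm_ring
  leibniz u v x y z := by
    ext
    simp only [Submodule.coe_add, Ring.lie_def]
    noncomm_ring

end LTSStruct

theorem mem_matrixA {M : Matrix (Fin 2) (Fin 2) ℝ} : M ∈ matrixA ↔ M 1 = 0 := Iff.rfl

theorem double_lie_mem_matrixA : ∀ E ∈ matrixA, ∀ F ∈ matrixA, ∀ G ∈ matrixA,
    ⁅⁅E, F⁆, G⁆ ∈ matrixA := by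
  intro E hE F hF G hG
  rw [mem_matrixA] at *
  ext j
  simp [Ring.lie_def, Matrix.mul_apply, Fin.sum_univ_two, hE, hF, hG]

/-- The Lie triple system on `matrixA` with product `⁅⁅E,F⁆,G⁆`. -/
noncomputable def matrixALTS : LTSStruct ℝ matrixA :=
  LTSStruct.ofAlgebra matrixA double_lie_mem_matrixA

theorem matrixA_ext {E F : matrixA} (h₀ : E.1 0 0 = F.1 0 0) (h₁ : E.1 0 1 = F.1 0 1) :
    E = F := by
  ext i j
  have hE := mem_matrixA.1 E.2
  have hF := mem_matrixA.1 F.2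
  fin_cases i <;> fin_cases j <;> simp_all

theorem matrixALTS_b_zero_zero (E F G : matrixA) : (matrixALTS.b E F G).1 0 0 = 0 := by
  have hE := mem_matrixA.1 E.2
  have hF := mem_matrixA.1 F.2
  have hG := mem_matrixA.1 G.2
  simp [matrixALTS, LTSStruct.ofAlgebra, Ring.lie_def, Matrix.mul_apply, Fin.sum_univ_two, hE, hF, hG]
  ring

theorem matrixALTS_b_zero_one (E F G : matrixA) : (matrixALTS.b E F G).1 0 1 =
    G.1 0 0 * (F.1 0 0 * E.1 0 1 - E.1 0 0 * F.1 0 1) := by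
  have hE := mem_matrixA.1 E.2
  have hF := mem_matrixA.1 F.2
  have hG := mem_matrixA.1 G.2
  simp [matrixALTS, LTSStruct.ofAlgebra, Ring.lie_def, Matrix.mul_apply, Fin.sum_univ_two, hE, hF, hG]
  ring

theorem matrixALTS_center : matrixALTS.center = {0} := by
  ext E
  simp only [LTSStruct.center, Set.mem_ofPred_eq, Set.mem_singleton_iff]
  constructor
  · intro h
    let P : matrixA := ⟨!![1, 0; 0, 0], by rw [mem_matrixA]; ext j; fin_cases j <;> rfl⟩
    let Q : matrixA := ⟨!![0, 1; 0, 0], by rw [mem_matrixA]; ext j; fin_cases j <;> rfl⟩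
    have hP := matrixALTS_b_zero_one E P P
    have hQ := matrixALTS_b_zero_one E Q P
    rw [h] at hP hQ
    exact matrixA_ext (by simpa [P, Q] using hQ) (by simpa [P] using hP.symm)
  · rintro rfl F G
    exact matrixA_ext (by simp [matrixALTS_b_zero_zero]) (by simp [matrixALTS_b_zero_one])

/-- The submodule of `matrixA` of matrices with zero first column. -/
def matrixAIdeal : Submodule ℝ matrixA where
  carrier := {M | M.1 0 0 = 0}
  add_mem' {E F} hE hF := by simp_all
  zero_mem' := by simp
  smul_mem' c E hE := by simp_all

theorem mem_matrixAIdeal {M : matrixA} : M ∈ matrixAIdeal ↔ M.1 0 0 = 0 := Iff.rfl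

theorem matrixAIdeal_ne_bot : matrixAIdeal ≠ ⊥ := by
  rw [Submodule.ne_bot_iff]
  refine ⟨⟨!![0, 1; 0, 0], by rw [mem_matrixA]; ext j; fin_cases j <;> rfl⟩,
    by simp [mem_matrixAIdeal], fun h => ?_⟩
  simpa using congrArg (fun M : matrixA => M.1 0 1) h

theorem matrixAIdeal_isIdeal : matrixALTS.IsIdeal matrixAIdeal :=
  fun E _ F G => matrixALTS_b_zero_zero E F G

theorem matrixALTS_b_eq_zero (E F : matrixA) {G : matrixA} (hG : G ∈ matrixAIdeal) :
    matrixALTS.b E F G = 0 :=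
  matrixA_ext (by simp [matrixALTS_b_zero_zero])
    (by simp [matrixALTS_b_zero_one, mem_matrixAIdeal.1 hG])

/-- the space `A` of `2 × 2` real matrices with zero second row is
a Lie triple system under `[E,F,G] = EFG − FEG − GEF + GFE` with zero center,
but it is not semiprime: the subspace of matrices with zero first column and
zero second row is a nonzero ideal `I` of `A` with `[A,I,I] = 0`. -/
theorem matrixA_center_zero_not_semiprime :
    ∃ L : LTSStruct ℝ ↥matrixA,
      (∀ E F G : ↥matrixA, ((L.b E F G : Matrix (Fin 2) (Fin 2) ℝ)) =
        (E : Matrix (Fin 2) (Fin 2) ℝ) * F * G - (F : Matrix (Fin 2) (Fin 2) ℝ) * E * G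
          - (G : Matrix (Fin 2) (Fin 2) ℝ) * E * F + (G : Matrix (Fin 2) (Fin 2) ℝ) * F * E) ∧
      L.center = {0} ∧
      ¬ L.IsSemiprime ∧
      ∃ I : Submodule ℝ ↥matrixA,
        (I : Set ↥matrixA) = {M : ↥matrixA | (M : Matrix (Fin 2) (Fin 2) ℝ) 0 0 = 0} ∧
        I ≠ ⊥ ∧ L.IsIdeal I ∧
        ∀ a : ↥matrixA, ∀ i ∈ I, ∀ j ∈ I, L.b a i j = 0 := by
  refine ⟨matrixALTS, fun E F G => ?_, matrixALTS_center, fun h => ?_, matrixAIdeal, rfl,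
    matrixAIdeal_ne_bot, matrixAIdeal_isIdeal, fun a i _ j hj => matrixALTS_b_eq_zero a i hj⟩
  · simp only [matrixALTS, LTSStruct.ofAlgebra, Ring.lie_def]
    noncomm_ring
  · obtain ⟨t, i, _, j, hj, hne⟩ := h _ matrixAIdeal_isIdeal matrixAIdeal_ne_bot
    exact hne (matrixALTS_b_eq_zero t i hj)
end

section
/- Every system of quotients S of a Lie triple system T over a field F is a weak system of quotients of T. -/
namespace LTSStruct

variable {F : Type*} [Field F] {S : Type*} [AddCommGroup S] [Module F S]

theorem mem_innerIdeal_self (L : LTSStruct F S) (T : Submodule F S) (s : S) :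
    s ∈ L.innerIdeal T s :=
  Submodule.subset_span InIter.base

theorem b_mem_of_left_mem_quotSet (L : LTSStruct F S) {T : Submodule F S} {s x y : S}
    (hx : x ∈ L.quotSet T s) (hy : y ∈ T) : L.b s x y ∈ T := by
  rw [L.b_swap]
  exact T.neg_mem (hx.2 y hy s (L.mem_innerIdeal_self T s)).2

theorem b_mem_of_right_mem_quotSet (L : LTSStruct F S) {T : Submodule F S} {s x y : S}
    (hx : x ∈ T) (hy : y ∈ L.quotSet T s) : L.b s x y ∈ T := by
  obtain ⟨hyx, hys⟩ := hy.2 x hx s (L.mem_innerIdeal_self T s)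
  have h : L.b s x y = L.b y x s - L.b y s x := by
    rw [L.b_swap y x s, eq_sub_iff_add_eq, eq_neg_iff_add_eq_zero, add_right_comm]
    exact L.cyclic s x y
  rw [h]
  exact T.sub_mem hyx hys

end LTSStruct

/-- every system of quotients is a weak system of quotients. -/
theorem isWeakSystemOfQuotients_of_isSystemOfQuotients
    {F S : Type*} [Field F] [AddCommGroup S] [Module F S]
    (L : LTSStruct F S) (T : Submodule F S) (h : L.IsSystemOfQuotients T) :
    L.IsWeakSystemOfQuotients T := by
  refine ⟨h.1, fun s hs => ?_⟩
  obtain ⟨x, hx, y, hy, hne, hmem⟩ := h.2 s s hs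
  exact ⟨x, hx, y, hy, hne, hmem.elim (fun hx' => L.b_mem_of_left_mem_quotSet hx' hy)
    (fun hy' => L.b_mem_of_right_mem_quotSet hx hy')⟩
end

section
/- Let S be a weak system of quotients of a Lie triple system T over a field F. If I is a nonzero ideal of S, then I ∩ T is a nonzero ideal of T. -/
/-- if `S` is a weak system of quotients of `T` and `I` is a
nonzero ideal of `S`, then `I ∩ T` is a nonzero ideal of `T`. -/
theorem inf_isIdealOf_of_isWeakSystemOfQuotients
    {F S : Type*} [Field F] [AddCommGroup S] [Module F S]
    (L : LTSStruct F S) (T : Submodule F S) (h : L.IsWeakSystemOfQuotients T)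
    (I : Submodule F S) (hI : L.IsIdeal I) (hne : I ≠ ⊥) :
    L.IsIdealOf (I ⊓ T) T ∧ I ⊓ T ≠ ⊥ := by
  refine ⟨⟨inf_le_right, fun x hx y hy z hz => ⟨hI x hx.1 y z, h.1 x hx.2 y hy z hz⟩⟩, ?_⟩
  obtain ⟨s, hs, hs0⟩ := I.ne_bot_iff.mp hne
  obtain ⟨x, -, y, -, hxy0, hxyT⟩ := h.2 s hs0
  exact (I ⊓ T).ne_bot_iff.mpr ⟨L.b s x y, ⟨hI s hs x y, hxyT⟩, hxy0⟩
end

section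
/- Let S be a weak system of quotients of a Lie triple system T over a field F. If T is semiprime, then S is semiprime; and if T is prime, then S is prime. -/
namespace LTSStruct

/-- The trace of an ideal of `S` on a subsystem `T` is an ideal of `T`. -/
theorem IsIdeal.inf_isIdealOf {F S : Type*} [Field F] [AddCommGroup S] [Module F S]
    {L : LTSStruct F S} {T I : Submodule F S} (hI : L.IsIdeal I) (hT : L.IsSubsystem T) :
    L.IsIdealOf (I ⊓ T) T :=
  ⟨inf_le_right, fun x hx y hy z hz => ⟨hI x hx.1 y z, hT x hx.2 y hy z hz⟩⟩

/-- A nonzero ideal of a weak system of quotients of `T` meets `T` nontrivially. -/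
theorem IsWeakSystemOfQuotients.inf_ne_bot {F S : Type*} [Field F] [AddCommGroup S] [Module F S]
    {L : LTSStruct F S} {T I : Submodule F S} (h : L.IsWeakSystemOfQuotients T)
    (hI : L.IsIdeal I) (hI₀ : I ≠ ⊥) : I ⊓ T ≠ ⊥ := by
  obtain ⟨s, hs, hs₀⟩ := I.ne_bot_iff.mp hI₀
  obtain ⟨x, -, y, -, hne, hmem⟩ := h.2 s hs₀
  exact (Submodule.ne_bot_iff _).mpr ⟨_, ⟨hI s hs x y, hmem⟩, hne⟩

end LTSStruct

/-- a weak system of quotients of a semiprime (prime) Lie triple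
system is semiprime (prime). -/
theorem semiprime_and_prime_lift_to_weak_system_of_quotients
    {F S : Type*} [Field F] [AddCommGroup S] [Module F S]
    (L : LTSStruct F S) (T : Submodule F S) (h : L.IsWeakSystemOfQuotients T) :
    (L.RelSemiprime T → L.IsSemiprime) ∧ (L.RelPrime T → L.IsPrime) := by
  constructor
  · intro hT I hI hI₀
    obtain ⟨t, -, i, hi, j, hj, hne⟩ := hT (I ⊓ T) (hI.inf_isIdealOf h.1) (h.inf_ne_bot hI hI₀)
    exact ⟨t, i, hi.1, j, hj.1, hne⟩
  · intro hT I J hI hJ hI₀ hJ₀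
    obtain ⟨t, -, i, hi, j, hj, hne⟩ := hT (I ⊓ T) (J ⊓ T) (hI.inf_isIdealOf h.1)
      (hJ.inf_isIdealOf h.1) (h.inf_ne_bot hI hI₀) (h.inf_ne_bot hJ hJ₀)
    exact ⟨t, i, hi.1, j, hj.1, hne⟩
end

section
/- Let L ⊆ Q be Lie algebras over a field F such that Q is an algebra of quotients of L. Regard Q and L as Lie triple systems with the triple product [a,b,c] = [[a,b],c]. Then Q (as a Lie triple system) is a system of quotients of L (as a Lie triple system). -/
/-- The Lie triple system structure `[a,b,c] = [[a,b],c]` on a Lie algebra. -/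
def lieLTS (F Q : Type*) [Field F] [LieRing Q] [LieAlgebra F Q] : LTSStruct F Q where
  b a c d := ⁅⁅a, c⁆, d⁆
  add₁ := by intros; simp [add_lie]
  smul₁ := by intros; simp
  add₂ := by intros; simp [lie_add, add_lie]
  smul₂ := by intros; simp
  add₃ := by intros; simp [lie_add]
  smul₃ := by intros; simp
  alt := by intros; simp
  cyclic := by
    intro x y z
    beta_reduce
    have h := lie_jacobi x y z
    have e1 : ⁅⁅x, y⁆, z⁆ = -⁅z, ⁅x, y⁆⁆ := by rw [lie_skew]
    have e2 : ⁅⁅y, z⁆, x⁆ = -⁅x, ⁅y, z⁆⁆ := by rw [lie_skew]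
    have e3 : ⁅⁅z, x⁆, y⁆ = -⁅y, ⁅z, x⁆⁆ := by rw [lie_skew]
    rw [e1, e2, e3]
    linear_combination (norm := abel) -h
  leibniz := by
    intro u v x y z
    beta_reduce
    rw [leibniz_lie ⁅u, v⁆ ⁅x, y⁆ z, leibniz_lie ⁅u, v⁆ x y, add_lie]

section LieQuotients

variable {F Q : Type*} [Field F] [LieRing Q] [LieAlgebra F Q] {L : LieSubalgebra F Q}
  {I : Submodule F Q}

/-- If an ideal `I` of `L` satisfies `[I, s] ⊆ L`, then `[I, u] ⊆ L` for every `u` in the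
span of the iterates `R(x₁,y₁)⋯R(xₙ,yₙ)(s)`. -/
theorem lie_mem_of_mem_innerIdeal {s : Q} (hideal : ∀ x ∈ I, ∀ y ∈ L, ⁅x, y⁆ ∈ I)
    (hs : ∀ i ∈ I, ⁅i, s⁆ ∈ L) {u : Q}
    (hu : u ∈ (lieLTS F Q).innerIdeal L.toSubmodule s) {i : Q} (hi : i ∈ I) :
    ⁅i, u⁆ ∈ L := by
  have lie_step : ∀ w : Q, (∀ i ∈ I, ⁅i, w⁆ ∈ L) → ∀ x ∈ L, ∀ i ∈ I, ⁅i, ⁅w, x⁆⁆ ∈ L := by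
    intro w hw x hx i hi
    have h := hw _ (hideal i hi x hx)
    rw [leibniz_lie, ← lie_skew w]
    exact L.add_mem (L.lie_mem (hw i hi) hx) (L.neg_mem h)
  have lie_iter : ∀ z, (lieLTS F Q).InIter L.toSubmodule s z → ∀ i ∈ I, ⁅i, z⁆ ∈ L := by
    intro z hz
    induction hz with
    | base => exact hs
    | step z x y _ hx hy ih => exact lie_step _ (lie_step z ih x hx) y hy
  induction hu using Submodule.span_induction with
  | mem z hz => exact lie_iter z hz i hi
  | zero => simp
  | add a b _ _ ha hb => rw [lie_add]; exact L.add_mem ha hb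
  | smul c a _ ha => rw [lie_smul]; exact L.smul_mem c ha

/-- An ideal `I` of `L` with `[I, s] ⊆ L` is contained in `(L : s)`. -/
theorem mem_quotSet_of_lie_mem {s : Q} (hIL : I ≤ L.toSubmodule)
    (hideal : ∀ x ∈ I, ∀ y ∈ L, ⁅x, y⁆ ∈ I) (hs : ∀ i ∈ I, ⁅i, s⁆ ∈ L) {i : Q} (hi : i ∈ I) :
    i ∈ (lieLTS F Q).quotSet L.toSubmodule s :=
  ⟨hIL hi, fun t ht _ hu =>
    ⟨lie_mem_of_mem_innerIdeal hideal hs hu (hideal i hi t ht),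
      L.lie_mem (lie_mem_of_mem_innerIdeal hideal hs hu hi) ht⟩⟩

/-- If every nonzero `q ∈ Q` satisfies `0 ≠ [J, q] ⊆ L` for some `J ⊆ L`, then an ideal of `L`
with zero centralizer in `L` has zero centralizer in `Q`. -/
theorem eq_zero_of_lie_ideal_eq_zero (hideal : ∀ x ∈ I, ∀ y ∈ L, ⁅x, y⁆ ∈ I)
    (hcent : ∀ x ∈ L, (∀ i ∈ I, ⁅x, i⁆ = 0) → x = 0)
    (habs : ∀ q : Q, q ≠ 0 → ∃ J : Submodule F Q, J ≤ L.toSubmodule ∧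
      (∃ j ∈ J, ⁅j, q⁆ ≠ 0) ∧ ∀ j ∈ J, ⁅j, q⁆ ∈ L)
    {q : Q} (hq : ∀ i ∈ I, ⁅q, i⁆ = 0) : q = 0 := by
  by_contra hne
  obtain ⟨J, hJL, ⟨j, hj, hjq⟩, hJ⟩ := habs q hne
  refine hjq (hcent _ (hJ j hj) fun i hi => ?_)
  have h := hq _ (hideal i hi j (hJL hj))
  rw [← lie_skew i j, lie_neg, neg_eq_zero] at h
  rw [lie_lie, hq i hi, h, lie_zero, sub_zero]

end LieQuotients

/-- if `Q` is an algebra of quotients of a Lie algebra `L`, then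
`Q`, regarded as a Lie triple system via `[a,b,c] = [[a,b],c]`, is a system of
quotients of the Lie triple system `L`. -/
theorem isSystemOfQuotients_of_lie_algebra_of_quotients
    {F Q : Type*} [Field F] [LieRing Q] [LieAlgebra F Q]
    (L : LieSubalgebra F Q)
    (hquot : ∀ q : Q, q ≠ 0 → ∃ I : Submodule F Q,
      I ≤ L.toSubmodule ∧
      (∀ x ∈ I, ∀ y ∈ L, ⁅x, y⁆ ∈ I) ∧
      ({x : Q | x ∈ L ∧ ∀ i ∈ I, ⁅x, i⁆ = 0} = {0}) ∧
      (∃ i ∈ I, ⁅i, q⁆ ≠ 0) ∧ (∀ i ∈ I, ⁅i, q⁆ ∈ L)) :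
    (lieLTS F Q).IsSystemOfQuotients L.toSubmodule := by
  refine ⟨fun x hx y hy z hz => L.lie_mem (L.lie_mem hx hy) hz, fun s s' hs => ?_⟩
  obtain ⟨I, hIL, hideal, hcent, hIs'⟩ : ∃ I : Submodule F Q, I ≤ L.toSubmodule ∧
      (∀ x ∈ I, ∀ y ∈ L, ⁅x, y⁆ ∈ I) ∧
      ({x : Q | x ∈ L ∧ ∀ i ∈ I, ⁅x, i⁆ = 0} = {0}) ∧ ∀ i ∈ I, ⁅i, s'⁆ ∈ L := by
    rcases eq_or_ne s' 0 with rfl | hs'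
    · obtain ⟨I, hIL, hideal, hcent, -⟩ := hquot s hs
      exact ⟨I, hIL, hideal, hcent, by simp⟩
    · obtain ⟨I, hIL, hideal, hcent, -, hI⟩ := hquot s' hs'
      exact ⟨I, hIL, hideal, hcent, hI⟩
  obtain ⟨J, hJL, -, -, ⟨j, hj, hjs⟩, -⟩ := hquot s hs
  obtain ⟨y, hy, hne⟩ : ∃ y ∈ I, ⁅⁅s, j⁆, y⁆ ≠ 0 := by
    by_contra! h
    have hsj : ⁅s, j⁆ = 0 := eq_zero_of_lie_ideal_eq_zero hideal
      (fun x hx hxI => hcent.subset ⟨hx, hxI⟩)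
      (fun q hq => let ⟨J, hJL, _, _, hJ⟩ := hquot q hq; ⟨J, hJL, hJ⟩) h
    rw [← lie_skew, hsj, neg_zero] at hjs
    exact hjs rfl
  exact ⟨j, hJL hj, y, hIL hy, hne, Or.inr (mem_quotSet_of_lie_mem hIL hideal hIs' hy)⟩
end

section
/- Let L be a Lie algebra over a field F which decomposes as an internal direct sum of subspaces L = L₀ ⊕ L₁ with [L₀,L₀] ⊆ L₀, [L₀,L₁] ⊆ L₁, [L₁,L₁] ⊆ L₀, such that L₀ = [L₁,L₁] and such that z ∈ L₀ with [z,L₁] = 0 implies z = 0. Set T = L₁, a Lie triple system under [a,b,c] := [[a,b],c]. Then for every ideal I of T: (1) C_L(I + [I,T]) ∩ T = C_T(I); (2) C_L(I + [I,T]) = 0 if and only if C_T(I) = 0, where C_L(J) = {x ∈ L : [x,J] = 0} for a subset J of L. -/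
/-- The centralizer `C_L(J) = {x ∈ L : [x,J] = 0}` of a subset of a Lie
algebra. -/
def lieCentralizer {L : Type*} [LieRing L] (J : Set L) : Set L :=
  {x | ∀ j ∈ J, ⁅x, j⁆ = 0}

/-- The span of `{⁅a, b⁆ : a ∈ I, b ∈ T}` in a Lie algebra. -/
def bracketSpan (F : Type*) {L : Type*} [Field F] [LieRing L] [LieAlgebra F L]
    (I T : Submodule F L) : Submodule F L :=
  Submodule.span F {z | ∃ a ∈ I, ∃ b ∈ T, z = ⁅a, b⁆}

theorem mem_lieCentralizer_sup_bracketSpan {F L : Type*} [Field F] [LieRing L] [LieAlgebra F L]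
    {I T : Submodule F L} {x : L} :
    x ∈ lieCentralizer ((I ⊔ bracketSpan F I T : Submodule F L) : Set L) ↔
      (∀ i ∈ I, ⁅x, i⁆ = 0) ∧ ∀ i ∈ I, ∀ t ∈ T, ⁅x, ⁅i, t⁆⁆ = 0 := by
  constructor
  · intro h
    exact ⟨fun i hi => h i (Submodule.mem_sup_left hi), fun i hi t ht =>
      h _ (Submodule.mem_sup_right (Submodule.subset_span ⟨i, hi, t, ht, rfl⟩))⟩
  · rintro ⟨h₁, h₂⟩
    have hle : I ⊔ bracketSpan F I T ≤ LinearMap.ker (LieAlgebra.ad F L x : L →ₗ[F] L) := by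
      refine sup_le (fun i hi => h₁ i hi) (Submodule.span_le.2 ?_)
      rintro _ ⟨i, hi, t, ht, rfl⟩
      exact h₂ i hi t ht
    exact fun j hj => hle hj

/-- for a Lie algebra `L = L₀ ⊕ L₁` abstracting the standard
embedding of the Lie triple system `T = L₁` (so `[L₀,L₀] ⊆ L₀`,
`[L₀,L₁] ⊆ L₁`, `[L₁,L₁] ⊆ L₀`, `L₀ = [L₁,L₁]`, and no nonzero element of `L₀`
annihilates `L₁`): for every ideal `I` of the Lie triple system `T = L₁`,
(1) `C_L(I + [I,T]) ∩ T = C_T(I)` and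
(2) `C_L(I + [I,T]) = 0 ↔ C_T(I) = 0`. -/
theorem standard_embedding_centralizer
    {F L : Type*} [Field F] [LieRing L] [LieAlgebra F L]
    (L0 L1 : Submodule F L)
    (hcompl : IsCompl L0 L1)
    (h00 : ∀ x ∈ L0, ∀ y ∈ L0, ⁅x, y⁆ ∈ L0)
    (h01 : ∀ x ∈ L0, ∀ y ∈ L1, ⁅x, y⁆ ∈ L1)
    (h11 : ∀ x ∈ L1, ∀ y ∈ L1, ⁅x, y⁆ ∈ L0)
    (hgen : L0 = bracketSpan F L1 L1)
    (hfaith : ∀ z ∈ L0, (∀ w ∈ L1, ⁅z, w⁆ = 0) → z = 0)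
    (I : Submodule F L) (hI : (lieLTS F L).IsIdealOf I L1) :
    (lieCentralizer ((I ⊔ bracketSpan F I L1 : Submodule F L) : Set L) ∩ (L1 : Set L)
        = (lieLTS F L).relCentralizer L1 (I : Set L)) ∧
    ((lieCentralizer ((I ⊔ bracketSpan F I L1 : Submodule F L) : Set L) = {0}) ↔
      (lieLTS F L).relCentralizer L1 (I : Set L) = {0}) := by
  have skew_eq_zero {x y : L} (h : ⁅x, y⁆ = 0) : ⁅y, x⁆ = 0 := by rw [← lie_skew, h, neg_zero]
  have hJ {x : L} := mem_lieCentralizer_sup_bracketSpan (I := I) (T := L1) (x := x)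
  have part_one : lieCentralizer ((I ⊔ bracketSpan F I L1 : Submodule F L) : Set L) ∩ (L1 : Set L)
      = (lieLTS F L).relCentralizer L1 (I : Set L) := by
    ext x
    constructor
    · rintro ⟨hx, hxT⟩
      obtain ⟨h₁, h₂⟩ := hJ.1 hx
      refine ⟨hxT, fun i hi t _ => ?_, fun t ht i hi => ?_⟩
      · change ⁅⁅x, i⁆, t⁆ = 0
        rw [h₁ i hi, zero_lie]
      · change ⁅⁅t, i⁆, x⁆ = 0
        rw [← lie_skew t i, neg_lie, skew_eq_zero (h₂ i hi t ht), neg_zero]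
    · rintro ⟨hxT, h₁, h₂⟩
      refine ⟨hJ.2 ⟨fun i hi => ?_, fun i hi t ht => ?_⟩, hxT⟩
      · exact hfaith _ (h11 x hxT i (hI.1 hi)) (h₁ i hi)
      · rw [← lie_skew i t, lie_neg, skew_eq_zero (h₂ t ht i hi), neg_zero]
  refine ⟨part_one, fun h => ?_, fun h => ?_⟩
  · rw [← part_one, h]
    ext x
    simp +contextual
  · refine Set.eq_singleton_iff_unique_mem.2 ⟨fun j _ => zero_lie j, fun x hx => ?_⟩
    have eq_zero_of_add {u v : L} (hu : u ∈ L0) (hv : v ∈ L1) (huv : u + v = 0) :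
        u = 0 ∧ v = 0 := by
      have hu' : u = 0 := (Submodule.disjoint_def.1 hcompl.disjoint) u hu
        (by rw [eq_neg_of_add_eq_zero_left huv]; exact L1.neg_mem hv)
      exact ⟨hu', by simpa [hu'] using huv⟩
    have h10 {a b : L} (ha : a ∈ L1) (hb : b ∈ L0) : ⁅a, b⁆ ∈ L1 := by
      rw [← lie_skew]
      exact L1.neg_mem (h01 b hb a ha)
    obtain ⟨x₀, hx₀, x₁, hx₁, rfl⟩ :=
      Submodule.mem_sup.1 (hcompl.sup_eq_top ▸ Submodule.mem_top : x ∈ L0 ⊔ L1)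
    obtain ⟨hxI, hxIT⟩ := hJ.1 hx
    have comp_I : ∀ i ∈ I, ⁅x₁, i⁆ = 0 ∧ ⁅x₀, i⁆ = 0 := fun i hi =>
      eq_zero_of_add (h11 _ hx₁ _ (hI.1 hi)) (h01 _ hx₀ _ (hI.1 hi))
        (by rw [add_comm, ← add_lie, hxI i hi])
    have comp_IT : ∀ i ∈ I, ∀ t ∈ L1, ⁅x₀, ⁅i, t⁆⁆ = 0 ∧ ⁅x₁, ⁅i, t⁆⁆ = 0 := fun i hi t ht =>
      eq_zero_of_add (h00 _ hx₀ _ (h11 _ (hI.1 hi) _ ht)) (h10 hx₁ (h11 _ (hI.1 hi) _ ht))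
        (by rw [← add_lie, hxIT i hi t ht])
    rw [← part_one] at h
    have hx₁_zero : x₁ = 0 := h.subset
      ⟨hJ.2 ⟨fun i hi => (comp_I i hi).1, fun i hi t ht => (comp_IT i hi t ht).2⟩, hx₁⟩
    have hx₀_zero : x₀ = 0 := by
      refine hfaith x₀ hx₀ fun t ht => h.subset
        ⟨hJ.2 ⟨fun i hi => ?_, fun i hi s hs => ?_⟩, h01 _ hx₀ _ ht⟩
      · rw [lie_lie, (comp_I i hi).2, lie_zero, sub_zero, ← lie_skew t i, lie_neg,
          (comp_IT i hi t ht).1, neg_zero]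
      · have hmem : ⁅⁅i, s⁆, t⁆ ∈ I := hI.2 i hi s hs t ht
        rw [lie_lie, (comp_IT i hi s hs).1, lie_zero, sub_zero, ← lie_skew t ⁅i, s⁆, lie_neg,
          (comp_I _ hmem).2, neg_zero]
    rw [hx₀_zero, hx₁_zero, add_zero]
end
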